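/- arXiv:2309.08405 — 6 statements merged into one kernel-verified Lean document; each statement's English description precedes it below -/
import Mathlib

section
/- Let n ≥ 1 and K ≥ 0 be integers and let P be a probability distribution on binary strings x ∈ {0,1}^n that admits a dependency graph G of maximum degree at most K, and suppose E_{x∼P}[x_j] ≤ 1/2 for every coordinate j. Let P_max = max_{x∈{0,1}^n} P(x) and let δ be a real number with 0 < δ ≤ P_max^{18/25}. Then Pr_{x∼P}[ ∑_{j=1}^n x_j ≥ (25/6)(K+1)·ln(1/δ) ] ≤ δ. -/
open Finset Matrix
open scoped Classical

/-- A graph all of whose degrees are at most `K` has a proper colouring with `K + 1` colours. -/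
theorem exists_proper_coloring_of_degree_le {V : Type*} [Fintype V] (G : SimpleGraph V) (K : ℕ)
    (hdeg : ∀ v, G.degree v ≤ K) :
    ∃ c : V → Fin (K + 1), ∀ a b, G.Adj a b → c a ≠ c b := by
  suffices h : ∀ s : Finset V, ∃ c : V → Fin (K + 1),
      ∀ a ∈ s, ∀ b ∈ s, G.Adj a b → c a ≠ c b by
    obtain ⟨c, hc⟩ := h Finset.univ
    exact ⟨c, fun a b => hc a (Finset.mem_univ a) b (Finset.mem_univ b)⟩
  intro s
  induction s using Finset.induction_on with
  | empty => exact ⟨fun _ => 0, by simp⟩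
  | insert v s hv ih =>
    obtain ⟨c, hc⟩ := ih
    have hcard : ((G.neighborFinset v).image c).card < (Finset.univ : Finset (Fin (K + 1))).card := by
      rw [Finset.card_univ, Fintype.card_fin]
      have h₁ := Finset.card_image_le (s := G.neighborFinset v) (f := c)
      rw [G.card_neighborFinset_eq_degree] at h₁
      exact Nat.lt_succ_of_le (h₁.trans (hdeg v))
    obtain ⟨k, -, hk⟩ := Finset.exists_mem_notMem_of_card_lt_card hcard
    have hk' : ∀ b, G.Adj v b → c b ≠ k := fun b hb h =>
      hk (Finset.mem_image.2 ⟨b, by simpa using hb, h⟩)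
    refine ⟨Function.update c v k, fun a ha b hb hab => ?_⟩
    by_cases hav : a = v
    · subst hav
      have hba : b ≠ a := hab.ne.symm
      simpa [hba] using (hk' b hab).symm
    · by_cases hbv : b = v
      · subst hbv
        simpa [hav] using hk' a hab.symm
      · simpa [hav, hbv] using hc a (Finset.mem_of_mem_insert_of_ne ha hav) b
          (Finset.mem_of_mem_insert_of_ne hb hbv) hab

/-- Along an independent set of a dependency graph, marginals are products of
one-coordinate marginals. -/
theorem marginal_eq_prod_of_independent {n : ℕ} (P : (Fin n → Bool) → ℝ) (hP1 : ∑ x, P x = 1)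
    (G : SimpleGraph (Fin n))
    (hdep : ∀ A B : Finset (Fin n), Disjoint A B →
      (∀ a ∈ A, ∀ b ∈ B, ¬ G.Adj a b) →
      ∀ f g : Fin n → Bool,
        (∑ x ∈ Finset.univ.filter
            (fun x => (∀ j ∈ A, x j = f j) ∧ (∀ j ∈ B, x j = g j)), P x)
          = (∑ x ∈ Finset.univ.filter (fun x => ∀ j ∈ A, x j = f j), P x)
            * (∑ x ∈ Finset.univ.filter (fun x => ∀ j ∈ B, x j = g j), P x))
    (f : Fin n → Bool) (C : Finset (Fin n)) (hC : ∀ a ∈ C, ∀ b ∈ C, ¬ G.Adj a b) :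
    ∑ x ∈ Finset.univ.filter (fun x => ∀ j ∈ C, x j = f j), P x
      = ∏ j ∈ C, ∑ x ∈ Finset.univ.filter (fun x : Fin n → Bool => x j = f j), P x := by
  induction C using Finset.induction_on with
  | empty => simpa using hP1
  | insert a C ha ih =>
    rw [Finset.prod_insert ha, ← ih fun b hb c hc =>
      hC b (Finset.mem_insert_of_mem hb) c (Finset.mem_insert_of_mem hc)]
    have h := hdep {a} C (by simpa using ha) (fun b hb c hc => by
      rw [Finset.mem_singleton] at hb
      exact hC b (hb ▸ Finset.mem_insert_self a C) c (Finset.mem_insert_of_mem hc)) f f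
    simpa [Finset.forall_mem_insert] using h

/-- The exponential moment of the weight on an independent set of a dependency graph, in terms of
the probability of an arbitrary string `y`. -/
theorem exp_moment_le_of_independent {n : ℕ} (P : (Fin n → Bool) → ℝ)
    (hP0 : ∀ x, 0 ≤ P x) (hP1 : ∑ x, P x = 1)
    (G : SimpleGraph (Fin n))
    (hdep : ∀ A B : Finset (Fin n), Disjoint A B →
      (∀ a ∈ A, ∀ b ∈ B, ¬ G.Adj a b) →
      ∀ f g : Fin n → Bool,
        (∑ x ∈ Finset.univ.filter
            (fun x => (∀ j ∈ A, x j = f j) ∧ (∀ j ∈ B, x j = g j)), P x)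
          = (∑ x ∈ Finset.univ.filter (fun x => ∀ j ∈ A, x j = f j), P x)
            * (∑ x ∈ Finset.univ.filter (fun x => ∀ j ∈ B, x j = g j), P x))
    (hmean : ∀ j : Fin n, ∑ x, P x * (if x j then (1:ℝ) else 0) ≤ 1/2)
    (C : Finset (Fin n)) (hC : ∀ a ∈ C, ∀ b ∈ C, ¬ G.Adj a b)
    (y : Fin n → Bool) (hy : 0 < P y) :
    ∑ x, P x * Real.exp (∑ j ∈ C, (if x j then (1:ℝ) else 0))
      ≤ Real.exp ((Real.exp 1 - 1) * (-Real.log (P y))) := by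
  set p : Fin n → ℝ := fun j => ∑ x, P x * (if x j then (1:ℝ) else 0) with hp
  have hp0 : ∀ j, 0 ≤ p j := fun j => Finset.sum_nonneg fun x _ =>
    mul_nonneg (hP0 x) (by split_ifs <;> norm_num)
  have hptrue : ∀ j, ∑ x ∈ Finset.univ.filter (fun x : Fin n → Bool => x j = true), P x = p j := by
    intro j
    simp [hp, Finset.sum_filter]
  have hpfalse : ∀ j,
      ∑ x ∈ Finset.univ.filter (fun x : Fin n → Bool => x j = false), P x = 1 - p j := by
    intro j
    rw [← hptrue j, ← hP1, eq_sub_iff_add_eq, add_comm,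
      ← Finset.sum_filter_add_sum_filter_not Finset.univ (fun x : Fin n → Bool => x j = true)]
    simp
  have he : 0 ≤ Real.exp 1 - 1 := by linarith [Real.add_one_le_exp (1:ℝ)]
  have hexp : ∀ x : Fin n → Bool, Real.exp (∑ j ∈ C, (if x j then (1:ℝ) else 0))
      = ∑ T ∈ C.powerset, (Real.exp 1 - 1) ^ T.card * (if ∀ j ∈ T, x j = true then 1 else 0) := by
    intro x
    have h₁ : ∀ j, Real.exp (if x j then (1:ℝ) else 0)
        = 1 + (Real.exp 1 - 1) * (if x j = true then (1:ℝ) else 0) := by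
      intro j
      split_ifs <;> simp
    rw [Real.exp_sum, Finset.prod_congr rfl fun j _ => h₁ j, Finset.prod_one_add]
    refine Finset.sum_congr rfl fun T _ => ?_
    rw [Finset.prod_mul_distrib, Finset.prod_const, Finset.prod_ite_zero]
    simp
  have hmoment : ∑ x, P x * Real.exp (∑ j ∈ C, (if x j then (1:ℝ) else 0))
      = ∏ j ∈ C, (1 + (Real.exp 1 - 1) * p j) := by
    simp_rw [hexp, Finset.mul_sum]
    rw [Finset.sum_comm, Finset.prod_one_add]
    refine Finset.sum_congr rfl fun T hT => ?_
    rw [Finset.mem_powerset] at hT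
    have h := marginal_eq_prod_of_independent P hP1 G hdep (fun _ => true) T
      fun a ha b hb => hC a (hT ha) b (hT hb)
    simp only [hptrue] at h
    rw [Finset.prod_mul_distrib, Finset.prod_const, ← h, Finset.sum_filter, Finset.mul_sum]
    refine Finset.sum_congr rfl fun x _ => ?_
    split_ifs <;> ring
  have hPy : P y ≤ Real.exp (-∑ j ∈ C, p j) := by
    calc P y ≤ ∑ x ∈ Finset.univ.filter (fun x => ∀ j ∈ C, x j = y j), P x :=
          Finset.single_le_sum (fun x _ => hP0 x) (by simp)
      _ = ∏ j ∈ C, ∑ x ∈ Finset.univ.filter (fun x : Fin n → Bool => x j = y j), P x :=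
          marginal_eq_prod_of_independent P hP1 G hdep y C hC
      _ ≤ ∏ j ∈ C, Real.exp (-p j) := by
          refine Finset.prod_le_prod (fun j _ => Finset.sum_nonneg fun x _ => hP0 x)
            fun j _ => ?_
          have h₁ : 1 - p j ≤ Real.exp (-p j) := Real.one_sub_le_exp_neg _
          have h₂ : p j ≤ 1 / 2 := hmean j
          cases hyj : y j with
          | true => rw [hptrue]; linarith
          | false => rw [hpfalse]; exact h₁
      _ = Real.exp (-∑ j ∈ C, p j) := by rw [← Real.exp_sum, Finset.sum_neg_distrib]
  have hmass : ∑ j ∈ C, p j ≤ -Real.log (P y) := by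
    have := (Real.log_le_iff_le_exp hy).2 hPy
    linarith
  rw [hmoment]
  calc ∏ j ∈ C, (1 + (Real.exp 1 - 1) * p j)
      ≤ ∏ j ∈ C, Real.exp ((Real.exp 1 - 1) * p j) :=
        Finset.prod_le_prod (fun j _ => by have := mul_nonneg he (hp0 j); linarith)
          fun j _ => by rw [add_comm]; exact Real.add_one_le_exp _
    _ = Real.exp ((Real.exp 1 - 1) * ∑ j ∈ C, p j) := by rw [← Real.exp_sum, Finset.mul_sum]
    _ ≤ _ := Real.exp_le_exp.2 (mul_le_mul_of_nonneg_left hmass he)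

/-- Hamming weight tail bound for a distribution on `{0,1}^n` with a
dependency graph of maximum degree `K` and coordinate means at most `1/2`. -/
theorem stmt_0 (n K : ℕ) (hn : 1 ≤ n)
    (P : (Fin n → Bool) → ℝ)
    (hP0 : ∀ x, 0 ≤ P x) (hP1 : ∑ x, P x = 1)
    (G : SimpleGraph (Fin n))
    (hdeg : ∀ v, G.degree v ≤ K)
    (hdep : ∀ A B : Finset (Fin n), Disjoint A B →
      (∀ a ∈ A, ∀ b ∈ B, ¬ G.Adj a b) →
      ∀ f g : Fin n → Bool,
        (∑ x ∈ Finset.univ.filter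
            (fun x => (∀ j ∈ A, x j = f j) ∧ (∀ j ∈ B, x j = g j)), P x)
          = (∑ x ∈ Finset.univ.filter (fun x => ∀ j ∈ A, x j = f j), P x)
            * (∑ x ∈ Finset.univ.filter (fun x => ∀ j ∈ B, x j = g j), P x))
    (hmean : ∀ j : Fin n, ∑ x, P x * (if x j then (1:ℝ) else 0) ≤ 1/2)
    (Pmax : ℝ) (hPmax : IsGreatest (Set.range P) Pmax)
    (δ : ℝ) (hδ0 : 0 < δ) (hδ : δ ≤ Pmax ^ ((18:ℝ)/25)) :
    ∑ x ∈ Finset.univ.filter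
        (fun x : Fin n → Bool =>
          (25/6 : ℝ) * (K + 1) * Real.log (1/δ) ≤ ∑ j, (if x j then (1:ℝ) else 0)),
      P x ≤ δ := by
  obtain ⟨y, rfl⟩ := hPmax.1
  have hy : 0 < P y := by
    refine (hP0 y).lt_of_ne fun h => ?_
    rw [← h, Real.zero_rpow (by norm_num)] at hδ
    linarith
  have hy1 : P y ≤ 1 := hP1 ▸ Finset.single_le_sum (fun x _ => hP0 x) (Finset.mem_univ y)
  obtain ⟨c, hc⟩ := exists_proper_coloring_of_degree_le G K hdeg
  set L : ℝ := -Real.log (P y) with hL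
  set D : ℝ := Real.log (1 / δ) with hD
  have hL0 : 0 ≤ L := neg_nonneg.2 (Real.log_nonpos hy.le hy1)
  have hDlog : D = -Real.log δ := by rw [hD, one_div, Real.log_inv]
  have hDL : 18 / 25 * L ≤ D := by
    have h := Real.log_le_log hδ0 hδ
    rw [Real.log_rpow hy] at h
    rw [hDlog, hL]
    linarith
  have hK : (0:ℝ) < (K:ℝ) + 1 := by positivity
  have hjensen : ∀ x : Fin n → Bool,
      Real.exp ((∑ j, (if x j then (1:ℝ) else 0)) / (K + 1))
        ≤ ∑ k : Fin (K + 1), ((K:ℝ) + 1)⁻¹ *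
          Real.exp (∑ j ∈ Finset.univ.filter (fun j => c j = k), (if x j then (1:ℝ) else 0)) := by
    intro x
    have h := convexOn_exp.map_sum_le (t := (Finset.univ : Finset (Fin (K + 1))))
      (w := fun _ => ((K:ℝ) + 1)⁻¹)
      (p := fun k => ∑ j ∈ Finset.univ.filter (fun j => c j = k), (if x j then (1:ℝ) else 0))
      (fun _ _ => by positivity) (by simp [hK.ne']) (fun _ _ => Set.mem_univ _)
    simp only [smul_eq_mul] at h
    rw [← Finset.mul_sum, Finset.sum_fiberwise] at h
    rwa [div_eq_inv_mul]
  have hmoment : ∑ x, P x * Real.exp ((∑ j, (if x j then (1:ℝ) else 0)) / (K + 1))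
      ≤ Real.exp ((Real.exp 1 - 1) * L) := by
    calc _ ≤ ∑ x, P x * ∑ k : Fin (K + 1), ((K:ℝ) + 1)⁻¹ *
          Real.exp (∑ j ∈ Finset.univ.filter (fun j => c j = k), (if x j then (1:ℝ) else 0)) :=
          Finset.sum_le_sum fun x _ => mul_le_mul_of_nonneg_left (hjensen x) (hP0 x)
      _ = ∑ k : Fin (K + 1), ((K:ℝ) + 1)⁻¹ * ∑ x, P x *
          Real.exp (∑ j ∈ Finset.univ.filter (fun j => c j = k), (if x j then (1:ℝ) else 0)) := by
          simp_rw [Finset.mul_sum]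
          rw [Finset.sum_comm]
          exact Finset.sum_congr rfl fun k _ => Finset.sum_congr rfl fun x _ => by ring
      _ ≤ ∑ k : Fin (K + 1), ((K:ℝ) + 1)⁻¹ * Real.exp ((Real.exp 1 - 1) * L) := by
          refine Finset.sum_le_sum fun k _ => mul_le_mul_of_nonneg_left ?_ (by positivity)
          refine exp_moment_le_of_independent P hP0 hP1 G hdep hmean _ (fun a ha b hb hab => ?_) y hy
          rw [Finset.mem_filter] at ha hb
          exact hc a b hab (ha.2.trans hb.2.symm)
      _ = _ := by
          simp [hK.ne']
  calc _ ≤ ∑ x, P x * Real.exp ((∑ j, (if x j then (1:ℝ) else 0)) / (K + 1) - 25 / 6 * D) := by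
        rw [Finset.sum_filter]
        refine Finset.sum_le_sum fun x _ => ?_
        split_ifs with hx
        · refine le_mul_of_one_le_right (hP0 x) (Real.one_le_exp (sub_nonneg.2 ?_))
          rw [le_div_iff₀ hK]
          linarith
        · exact mul_nonneg (hP0 x) (Real.exp_pos _).le
    _ = Real.exp (-(25 / 6 * D)) *
          ∑ x, P x * Real.exp ((∑ j, (if x j then (1:ℝ) else 0)) / (K + 1)) := by
        rw [Finset.mul_sum]
        refine Finset.sum_congr rfl fun x _ => ?_
        rw [sub_eq_add_neg, Real.exp_add]
        ring
    _ ≤ Real.exp (-(25 / 6 * D)) * Real.exp ((Real.exp 1 - 1) * L) :=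
        mul_le_mul_of_nonneg_left hmoment (Real.exp_pos _).le
    _ ≤ Real.exp (-D) := by
        rw [← Real.exp_add, Real.exp_le_exp]
        have h₁ : (Real.exp 1 - 1) * L ≤ 2 * L :=
          mul_le_mul_of_nonneg_right (by linarith [Real.exp_one_lt_d9]) hL0
        linarith
    _ = δ := by rw [hDlog, neg_neg, Real.exp_log hδ0]
end

section
/- Let n ≥ 1 and K ≥ 0 be integers and let P be a probability distribution on binary strings x ∈ {0,1}^n that admits a dependency graph G of maximum degree at most K, and suppose E_{x∼P}[x_j] ≤ 1/2 for every coordinate j. Let P_max = max_{x∈{0,1}^n} P(x). Then the expected Hamming weight satisfies E_{x∼P}[ ∑_{j=1}^n x_j ] ≤ (K+1)·ln(1/P_max). -/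
open Finset Matrix
open scoped Classical

/-- Greedy colouring: a finite graph of maximum degree at most `K` is `(K + 1)`-colorable. -/
theorem SimpleGraph.colorable_succ_of_degree_le {V : Type*} [Fintype V] (G : SimpleGraph V)
    {K : ℕ} (hdeg : ∀ v, G.degree v ≤ K) : G.Colorable (K + 1) := by
  have partialColoring : ∀ S : Finset V, ∃ c : V → Fin (K + 1),
      ∀ u ∈ S, ∀ v ∈ S, G.Adj u v → c u ≠ c v := by
    intro S
    induction S using Finset.induction_on with
    | empty => exact ⟨fun _ => 0, by simp⟩
    | insert a S ha ih =>
      obtain ⟨c, hc⟩ := ih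
      obtain ⟨k, hk⟩ : ∃ k, k ∉ (G.neighborFinset a).image c := by
        by_contra! h
        have hcard : Fintype.card (Fin (K + 1)) ≤ ((G.neighborFinset a).image c).card := by
          rw [Finset.eq_univ_of_forall h, Finset.card_univ]
        have hle := hcard.trans Finset.card_image_le
        rw [Fintype.card_fin, G.card_neighborFinset_eq_degree] at hle
        have := hdeg a
        omega
      have hk' : ∀ v, G.Adj a v → c v ≠ k := fun v hv hvk =>
        hk (Finset.mem_image.2 ⟨v, (G.mem_neighborFinset a v).2 hv, hvk⟩)
      refine ⟨Function.update c a k, fun u hu v hv huv => ?_⟩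
      rcases eq_or_ne u a with rfl | hua
      · rw [Function.update_self, Function.update_of_ne huv.ne']
        exact (hk' v huv).symm
      · rw [Function.update_of_ne hua]
        rcases eq_or_ne v a with rfl | hva
        · rw [Function.update_self]
          exact hk' u huv.symm
        · rw [Function.update_of_ne hva]
          exact hc u (Finset.mem_of_mem_insert_of_ne hu hua) v
            (Finset.mem_of_mem_insert_of_ne hv hva) huv
  obtain ⟨c, hc⟩ := partialColoring Finset.univ
  exact ⟨SimpleGraph.Coloring.mk c fun {u v} huv =>
    hc u (Finset.mem_univ u) v (Finset.mem_univ v) huv⟩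

/-- If a coordinate has mean `p ≤ 1/2`, it takes any prescribed value with probability at most
`exp (-p)`. -/
theorem sum_filter_apply_eq_le_exp_neg_mean {ι : Type*} [Fintype ι] [DecidableEq ι]
    {P : (ι → Bool) → ℝ}
    (hP1 : ∑ x, P x = 1) {j : ι}
    (hmean : ∑ x, P x * (if x j then (1 : ℝ) else 0) ≤ 1 / 2) (b : Bool) :
    ∑ x with x j = b, P x ≤ Real.exp (-∑ x, P x * (if x j then (1 : ℝ) else 0)) := by
  have htrue : ∑ x with x j = true, P x = ∑ x, P x * (if x j then (1 : ℝ) else 0) := by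
    simp [Finset.sum_filter]
  have hsplit := Finset.sum_filter_add_sum_filter_not Finset.univ (fun x => x j = true) P
  simp only [Bool.not_eq_true, hP1] at hsplit
  have hexp := Real.add_one_le_exp (-∑ x, P x * (if x j then (1 : ℝ) else 0))
  cases b <;> linarith

/-- The probability of any cylinder over an independent set `I` of the dependency graph is at most
`exp (-∑ j ∈ I, p j)`, where the means `p j` are at most `1/2`. -/
theorem sum_cylinder_le_exp_neg_sum_mean {ι : Type*} [Fintype ι] [DecidableEq ι]
    {P : (ι → Bool) → ℝ}
    (hP0 : ∀ x, 0 ≤ P x) (hP1 : ∑ x, P x = 1) {G : SimpleGraph ι}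
    (hdep : ∀ A B : Finset ι, Disjoint A B →
      (∀ a ∈ A, ∀ b ∈ B, ¬ G.Adj a b) →
      ∀ f g : ι → Bool,
        (∑ x with (∀ j ∈ A, x j = f j) ∧ (∀ j ∈ B, x j = g j), P x)
          = (∑ x with ∀ j ∈ A, x j = f j, P x) * (∑ x with ∀ j ∈ B, x j = g j, P x))
    (hmean : ∀ j, ∑ x, P x * (if x j then (1 : ℝ) else 0) ≤ 1 / 2)
    (y : ι → Bool) (I : Finset ι) (hI : ∀ u ∈ I, ∀ v ∈ I, ¬ G.Adj u v) :
    ∑ x with ∀ j ∈ I, x j = y j, P x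
      ≤ Real.exp (-∑ j ∈ I, ∑ x, P x * (if x j then (1 : ℝ) else 0)) := by
  induction I using Finset.induction_on with
  | empty => simp [hP1]
  | insert a S ha ih =>
    have hS := ih fun u hu v hv =>
      hI u (Finset.mem_insert_of_mem hu) v (Finset.mem_insert_of_mem hv)
    have hprod := hdep {a} S (Finset.disjoint_singleton_left.2 ha) (fun u hu v hv => by
      rw [Finset.mem_singleton.1 hu]
      exact hI a (Finset.mem_insert_self a S) v (Finset.mem_insert_of_mem hv)) y y
    simp only [Finset.mem_singleton, forall_eq] at hprod
    simp only [Finset.forall_mem_insert]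
    rw [hprod, Finset.sum_insert ha, neg_add, Real.exp_add]
    exact mul_le_mul (sum_filter_apply_eq_le_exp_neg_mean hP1 (hmean a) (y a)) hS
      (Finset.sum_nonneg fun x _ => hP0 x) (Real.exp_pos _).le

/-- expected Hamming weight bound `E[w(x)] ≤ (K+1)·ln(1/P_max)` for a
distribution on `{0,1}^n` with a dependency graph of maximum degree `K` and
coordinate means at most `1/2`. -/
theorem stmt_1 (n K : ℕ) (hn : 1 ≤ n)
    (P : (Fin n → Bool) → ℝ)
    (hP0 : ∀ x, 0 ≤ P x) (hP1 : ∑ x, P x = 1)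
    (G : SimpleGraph (Fin n))
    (hdeg : ∀ v, G.degree v ≤ K)
    (hdep : ∀ A B : Finset (Fin n), Disjoint A B →
      (∀ a ∈ A, ∀ b ∈ B, ¬ G.Adj a b) →
      ∀ f g : Fin n → Bool,
        (∑ x ∈ Finset.univ.filter
            (fun x => (∀ j ∈ A, x j = f j) ∧ (∀ j ∈ B, x j = g j)), P x)
          = (∑ x ∈ Finset.univ.filter (fun x => ∀ j ∈ A, x j = f j), P x)
            * (∑ x ∈ Finset.univ.filter (fun x => ∀ j ∈ B, x j = g j), P x))
    (hmean : ∀ j : Fin n, ∑ x, P x * (if x j then (1:ℝ) else 0) ≤ 1/2)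
    (Pmax : ℝ) (hPmax : IsGreatest (Set.range P) Pmax) :
    ∑ x, P x * (∑ j, (if x j then (1:ℝ) else 0)) ≤ (K + 1) * Real.log (1/Pmax) := by
  obtain ⟨⟨y, hy⟩, hmax⟩ := hPmax
  have hpos : 0 < Pmax := by
    by_contra! h
    have hle : ∑ x, P x ≤ 0 :=
      Finset.sum_nonpos fun x _ => (hmax (Set.mem_range_self x)).trans h
    linarith
  obtain ⟨c⟩ := G.colorable_succ_of_degree_le hdeg
  have hclass : ∀ k : Fin (K + 1),
      ∑ j with c j = k, ∑ x, P x * (if x j then (1 : ℝ) else 0) ≤ Real.log (1 / Pmax) := by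
    intro k
    have hcyl := sum_cylinder_le_exp_neg_sum_mean hP0 hP1 (by convert hdep) hmean y
      (Finset.univ.filter fun j => c j = k) (fun u hu v hv huv => c.valid huv
        ((Finset.mem_filter.1 hu).2.trans (Finset.mem_filter.1 hv).2.symm))
    have hlog := (Real.log_le_iff_le_exp hpos).2 (hcyl.trans' (hy.symm.le.trans
      (Finset.single_le_sum (f := P) (fun x _ => hP0 x) (by simp))))
    rw [one_div, Real.log_inv]
    linarith
  calc ∑ x, P x * (∑ j, (if x j then (1:ℝ) else 0))
      = ∑ j, ∑ x, P x * (if x j then (1 : ℝ) else 0) := by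
        simp only [Finset.mul_sum]
        exact Finset.sum_comm
    _ = ∑ k : Fin (K + 1), ∑ j with c j = k, ∑ x, P x * (if x j then (1 : ℝ) else 0) :=
        (Finset.sum_fiberwise _ _ _).symm
    _ ≤ ∑ _k : Fin (K + 1), Real.log (1 / Pmax) := Finset.sum_le_sum fun k _ => hclass k
    _ = (K + 1) * Real.log (1 / Pmax) := by simp
end

section
/- Let G be a simple graph on vertex set {1,…,n} in which every vertex has degree at most K, and let m_1,…,m_n be nonnegative real weights. Then there exists an independent set S of G (a set of pairwise non-adjacent vertices) such that ∑_{j∈S} m_j ≥ (1/(K+1))·∑_{j=1}^n m_j. -/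
open Finset
open scoped Classical

/-- Greedy choice of a heavy independent set inside `T`: repeatedly take a heaviest vertex and
discard its neighbours. -/
theorem SimpleGraph.exists_isIndepSet_sum_le_mul_sum {V : Type*} [Fintype V]
    (G : SimpleGraph V) {K : ℕ} (hdeg : ∀ v, G.degree v ≤ K) {m : V → ℝ} (hm : ∀ v, 0 ≤ m v)
    (T : Finset V) :
    ∃ S ⊆ T, G.IsIndepSet (S : Set V) ∧ ∑ v ∈ T, m v ≤ (K + 1) * ∑ v ∈ S, m v := by
  induction T using Finset.strongInduction with
  | H T ih =>
    rcases T.eq_empty_or_nonempty with rfl | hT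
    · exact ⟨∅, by simp⟩
    obtain ⟨v, hvT, hv⟩ := T.exists_max_image m hT
    set N := insert v (G.neighborFinset v)
    have hvN : v ∈ N := mem_insert_self _ _
    obtain ⟨S, hST, hS, hle⟩ := ih (T \ N)
      ⟨sdiff_subset, fun h => (mem_sdiff.1 (h hvT)).2 hvN⟩
    have hvS : v ∉ S := fun h => (mem_sdiff.1 (hST h)).2 hvN
    refine ⟨insert v S, insert_subset hvT (hST.trans sdiff_subset), ?_, ?_⟩
    · rw [coe_insert, SimpleGraph.IsIndepSet, Set.pairwise_insert]
      have hnadj : ∀ w ∈ S, ¬ G.Adj v w := fun w hw hadj =>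
        (mem_sdiff.1 (hST hw)).2 (mem_insert_of_mem ((G.mem_neighborFinset v w).2 hadj))
      exact ⟨hS, fun w hw _ => ⟨hnadj w hw, fun h => hnadj w hw h.symm⟩⟩
    · have hcard : (#(T ∩ N) : ℝ) ≤ K + 1 := by
        exact_mod_cast (card_le_card inter_subset_right).trans
          ((card_insert_le _ _).trans (Nat.succ_le_succ (hdeg v)))
      have hN : ∑ w ∈ T ∩ N, m w ≤ (K + 1) * m v :=
        calc ∑ w ∈ T ∩ N, m w ≤ #(T ∩ N) • m v :=
              sum_le_card_nsmul _ _ _ fun w hw => hv w (mem_inter.1 hw).1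
          _ = #(T ∩ N) * m v := nsmul_eq_mul _ _
          _ ≤ (K + 1) * m v := mul_le_mul_of_nonneg_right hcard (hm v)
      rw [sum_insert hvS, ← sum_inter_add_sum_sdiff T N]
      linarith

/-- any graph of maximum degree at most `K` with nonnegative vertex
weights has an independent set carrying at least a `1/(K+1)` fraction of the total
weight. -/
theorem stmt_2 (n K : ℕ)
    (G : SimpleGraph (Fin n))
    (hdeg : ∀ v, G.degree v ≤ K)
    (m : Fin n → ℝ) (hm : ∀ j, 0 ≤ m j) :
    ∃ S : Finset (Fin n),
      (∀ a ∈ S, ∀ b ∈ S, a ≠ b → ¬ G.Adj a b) ∧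
      (1 / (K + 1) : ℝ) * ∑ j, m j ≤ ∑ j ∈ S, m j := by
  obtain ⟨S, -, hS, hle⟩ := G.exists_isIndepSet_sum_le_mul_sum hdeg hm univ
  refine ⟨S, fun a ha b hb hab => hS ha hb hab, ?_⟩
  rw [one_div, inv_mul_le_iff₀ (by positivity)]
  exact hle
end

section
/- Let H be an N×N Hermitian complex matrix with 0 ≤ H ≤ I in the Loewner order, let ψ ∈ ℂ^N be a unit vector with Hψ = ψ, let Π be an N×N orthogonal projection matrix, and let δ ∈ [0,1] satisfy ⟨ψ, Πψ⟩ ≥ 1 − δ. Then the largest eigenvalue of the Hermitian matrix G = ΠHΠ satisfies λ_1(G) ≥ 1 − 3√δ. -/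
open Matrix
open scoped Classical ComplexOrder

/-- Rayleigh bound: an upper bound `c` on the eigenvalues of a Hermitian matrix `A` gives
`A ≤ c • 1` in the Loewner order. -/
theorem Matrix.IsHermitian.posSemidef_smul_one_sub {n : Type*} [Fintype n] [DecidableEq n]
    {A : Matrix n n ℂ} (hA : A.IsHermitian) {c : ℝ} (hc : ∀ i, hA.eigenvalues i ≤ c) :
    ((c : ℂ) • (1 : Matrix n n ℂ) - A).PosSemidef := by
  set U : Matrix n n ℂ := (hA.eigenvectorUnitary : Matrix n n ℂ)
  have hUU : U * Uᴴ = 1 := Unitary.mul_star_self_of_mem hA.eigenvectorUnitary.2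
  have hspec : A = U * diagonal (fun i => (hA.eigenvalues i : ℂ)) * Uᴴ := hA.spectral_theorem
  have hdiag : (diagonal fun i => (c : ℂ) - (hA.eigenvalues i : ℂ)).PosSemidef := by
    refine PosSemidef.diagonal fun i => ?_
    have h : (0 : ℝ) ≤ c - hA.eigenvalues i := sub_nonneg.mpr (hc i)
    simpa using Complex.zero_le_real.mpr h
  have hconj := hdiag.mul_mul_conjTranspose_same U
  have hsplit : (diagonal fun i => (c : ℂ) - (hA.eigenvalues i : ℂ)) =
      (c : ℂ) • (1 : Matrix n n ℂ) - diagonal (fun i => (hA.eigenvalues i : ℂ)) := by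
    rw [smul_one_eq_diagonal, diagonal_sub]
  rw [hsplit, mul_sub, sub_mul, ← hspec, mul_smul_comm, mul_one, smul_mul_assoc, hUU] at hconj
  exact hconj

/-- A positive semidefinite matrix dominates the rank-one projection onto any of its
unit eigenvectors of eigenvalue one. -/
theorem Matrix.PosSemidef.normSq_dotProduct_le {n : Type*} [Fintype n]
    {H : Matrix n n ℂ} (hH : H.PosSemidef) {ψ : n → ℂ} (hψ : star ψ ⬝ᵥ ψ = 1)
    (hHψ : H *ᵥ ψ = ψ) (φ : n → ℂ) :
    star (star ψ ⬝ᵥ φ) * (star ψ ⬝ᵥ φ) ≤ star φ ⬝ᵥ (H *ᵥ φ) := by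
  set a := star ψ ⬝ᵥ φ with ha
  have hφψ : star φ ⬝ᵥ ψ = star a := by
    rw [ha, star_dotProduct]
  have hψH : star ψ ⬝ᵥ (H *ᵥ φ) = a := by
    rw [dotProduct_mulVec, ← hH.1.eq, ← star_mulVec, hHψ]
  have hw := hH.dotProduct_mulVec_nonneg (φ - a • ψ)
  rw [mulVec_sub, mulVec_smul, hHψ, star_sub, star_smul] at hw
  simp only [sub_dotProduct, dotProduct_sub, smul_dotProduct, dotProduct_smul, hφψ, hψH, hψ,
    smul_eq_mul] at hw
  rw [← sub_nonneg]
  convert hw using 1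
  ring

/-- if `0 ≤ H ≤ I`, `Hψ = ψ` for a unit vector `ψ`, and `Π` is an
orthogonal projection with `⟨ψ, Πψ⟩ ≥ 1 − δ`, then the largest eigenvalue of
`G = ΠHΠ` is at least `1 − 3√δ`. -/
theorem stmt_5 (N : ℕ) (hN : 1 ≤ N)
    (H : Matrix (Fin N) (Fin N) ℂ)
    (hHpsd : H.PosSemidef) (hHle : (1 - H).PosSemidef)
    (ψ : Fin N → ℂ) (hψ : star ψ ⬝ᵥ ψ = 1) (hHψ : H *ᵥ ψ = ψ)
    (Pj : Matrix (Fin N) (Fin N) ℂ) (hPjH : Pj.IsHermitian) (hPj2 : Pj * Pj = Pj)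
    (δ : ℝ) (hδ0 : 0 ≤ δ) (hδ1 : δ ≤ 1)
    (hover : 1 - δ ≤ (star ψ ⬝ᵥ (Pj *ᵥ ψ)).re)
    (hG : (Pj * H * Pj).IsHermitian) :
    haveI : Nonempty (Fin N) := Fin.pos_iff_nonempty.mp hN
    1 - 3 * Real.sqrt δ ≤ ⨆ i, hG.eigenvalues i := by
  have hle : ∀ i, hG.eigenvalues i ≤ ⨆ i, hG.eigenvalues i :=
    le_ciSup (Set.finite_range _).bddAbove
  set c := ⨆ i, hG.eigenvalues i
  have hc0 : 0 ≤ c := by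
    have hGpsd : (Pj * H * Pj).PosSemidef := by
      simpa only [hPjH.eq] using hHpsd.conjTranspose_mul_mul_same Pj
    exact (hGpsd.eigenvalues_nonneg ⟨0, hN⟩).trans (hle _)
  set φ := Pj *ᵥ ψ with hφ
  have hPφ : Pj *ᵥ φ = φ := by rw [hφ, mulVec_mulVec, hPj2]
  have hstarφ : star φ = star ψ ᵥ* Pj := by rw [hφ, star_mulVec, hPjH.eq]
  have hφφ : star φ ⬝ᵥ φ = star ψ ⬝ᵥ φ := by
    rw [hstarφ, ← dotProduct_mulVec, hPφ]
  have hφG : star φ ⬝ᵥ ((Pj * H * Pj) *ᵥ φ) = star φ ⬝ᵥ (H *ᵥ φ) := by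
    rw [← mulVec_mulVec, hPφ, ← mulVec_mulVec, dotProduct_mulVec (star φ) Pj, ← hPjH.eq,
      ← star_mulVec, hPφ]
  have hray := (hG.posSemidef_smul_one_sub hle).dotProduct_mulVec_nonneg φ
  rw [sub_mulVec, smul_mulVec, one_mulVec, dotProduct_sub, dotProduct_smul, hφG, hφφ,
    smul_eq_mul, sub_nonneg] at hray
  have hsq := (hHpsd.normSq_dotProduct_le hψ hHψ φ).trans hray
  have hreal : star ψ ⬝ᵥ φ = ((star ψ ⬝ᵥ φ).re : ℂ) := by
    have h0 : 0 ≤ star ψ ⬝ᵥ φ := hφφ ▸ dotProduct_star_self_nonneg φ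
    exact Complex.eq_re_of_ofReal_le h0
  set p := (star ψ ⬝ᵥ φ).re
  have hpc : p * p ≤ c * p := by
    rw [hreal, Complex.star_def, Complex.conj_ofReal] at hsq
    exact_mod_cast hsq
  have hp : p ≤ c := by
    by_contra! h
    nlinarith
  have hδ : δ ≤ √δ := Real.le_sqrt_of_sq_le (by nlinarith)
  linarith [Real.sqrt_nonneg δ]
end

section
/- Let n ≥ 2 and K ≥ 0 be integers, let a ≥ 1 be an integer, and let P be a probability distribution on binary strings x ∈ {0,1}^n that admits a dependency graph G of maximum degree at most K, with E_{x∼P}[x_j] ≤ 1/2 for every coordinate j. If h ∈ {0,1}^n satisfies P(h) ≥ n^{−a}, then the Hamming weight of h satisfies w(h) ≤ (25/3)·a·(K+1)·ln(n). -/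
open Finset
open scoped Classical

/-- Every finite set of vertices of a graph with degrees at most `K` contains an independent set
holding at least a `1 / (K + 1)` fraction of it. -/
theorem exists_isIndepSet_subset_card_le {V : Type*} [Fintype V] (G : SimpleGraph V) {K : ℕ}
    (hdeg : ∀ v, G.degree v ≤ K) (S : Finset V) :
    ∃ I ⊆ S, G.IsIndepSet (I : Set V) ∧ #S ≤ #I * (K + 1) := by
  induction S using Finset.strongInduction with
  | H S ih =>
    rcases S.eq_empty_or_nonempty with rfl | ⟨v, hv⟩
    · exact ⟨∅, by simp, by simp [SimpleGraph.IsIndepSet], by simp⟩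
    · set N := insert v (G.neighborFinset v) with hN
      have hvN : v ∈ N := mem_insert_self _ _
      obtain ⟨I, hIS, hI, hcard⟩ := ih (S \ N)
        ((ssubset_iff_of_subset sdiff_subset).2 ⟨v, hv, by simp [hvN]⟩)
      have hIN : ∀ w ∈ I, w ∉ N := fun w hw => (mem_sdiff.1 (hIS hw)).2
      refine ⟨insert v I, insert_subset hv (hIS.trans sdiff_subset), ?_, ?_⟩
      · rw [coe_insert]
        refine hI.insert fun w hw _ => ?_
        have : ¬ G.Adj v w := fun hvw => hIN w hw (by simp [hN, hvw])
        exact ⟨this, fun hwv => this hwv.symm⟩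
      · have hcardN : #N ≤ K + 1 := (card_insert_le _ _).trans (by simpa using hdeg v)
        have hcardS := le_card_sdiff N S
        rw [card_insert_of_notMem fun hvI => hIN v hvI hvN, add_mul, one_mul]
        omega

/-- The probability that all coordinates of an independent set of a dependency graph equal `1` is
at most the product of the bounds on the individual coordinates. -/
theorem sum_filter_true_on_isIndepSet_le {V : Type*} [Fintype V] [DecidableEq V]
    (P : (V → Bool) → ℝ)
    (hP0 : ∀ x, 0 ≤ P x) (hP1 : ∑ x, P x = 1) (G : SimpleGraph V)
    (hdep : ∀ A B : Finset V, Disjoint A B → (∀ u ∈ A, ∀ v ∈ B, ¬ G.Adj u v) →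
      ∀ f g : V → Bool,
        (∑ x ∈ univ.filter (fun x => (∀ j ∈ A, x j = f j) ∧ (∀ j ∈ B, x j = g j)), P x)
          = (∑ x ∈ univ.filter (fun x => ∀ j ∈ A, x j = f j), P x)
            * (∑ x ∈ univ.filter (fun x => ∀ j ∈ B, x j = g j), P x))
    {p : ℝ} (hp : 0 ≤ p) (hmean : ∀ j, ∑ x, P x * (if x j then (1 : ℝ) else 0) ≤ p)
    (I : Finset V) (hI : G.IsIndepSet (I : Set V)) :
    ∑ x ∈ univ.filter (fun x => ∀ j ∈ I, x j = true), P x ≤ p ^ #I := by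
  induction I using Finset.induction_on with
  | empty => simp [hP1]
  | insert v I hv ih =>
    rw [coe_insert] at hI
    have hadj : ∀ u ∈ ({v} : Finset V), ∀ w ∈ I, ¬ G.Adj u w := by
      intro u hu w hw
      rw [mem_singleton] at hu
      subst hu
      exact hI (Set.mem_insert _ _) (Set.mem_insert_of_mem _ hw) fun huw => hv (huw ▸ hw)
    have hprod := hdep {v} I (disjoint_singleton_left.2 hv) hadj (fun _ => true) (fun _ => true)
    have hone : ∑ x ∈ univ.filter (fun x : V → Bool => ∀ j ∈ ({v} : Finset V), x j = true), P x
        ≤ p := by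
      simpa [sum_filter] using hmean v
    simp only [forall_mem_insert]
    simp only [mem_singleton, forall_eq] at hprod hone
    rw [hprod, card_insert_of_notMem hv, pow_succ']
    exact mul_le_mul hone (ih (hI.mono (Set.subset_insert _ _)))
      (sum_nonneg fun x _ => hP0 x) hp

/-- if a distribution on `{0,1}^n` has a dependency graph of maximum
degree `K`, coordinate means at most `1/2`, and `P(h) ≥ n^{−a}` for some string
`h`, then the Hamming weight of `h` is at most `(25/3)·a·(K+1)·ln n`. -/
theorem stmt_8 (n K : ℕ) (hn : 2 ≤ n) (a : ℕ) (ha : 1 ≤ a)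
    (P : (Fin n → Bool) → ℝ)
    (hP0 : ∀ x, 0 ≤ P x) (hP1 : ∑ x, P x = 1)
    (G : SimpleGraph (Fin n))
    (hdeg : ∀ v, G.degree v ≤ K)
    (hdep : ∀ A B : Finset (Fin n), Disjoint A B →
      (∀ u ∈ A, ∀ v ∈ B, ¬ G.Adj u v) →
      ∀ f g : Fin n → Bool,
        (∑ x ∈ Finset.univ.filter
            (fun x => (∀ j ∈ A, x j = f j) ∧ (∀ j ∈ B, x j = g j)), P x)
          = (∑ x ∈ Finset.univ.filter (fun x => ∀ j ∈ A, x j = f j), P x)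
            * (∑ x ∈ Finset.univ.filter (fun x => ∀ j ∈ B, x j = g j), P x))
    (hmean : ∀ j : Fin n, ∑ x, P x * (if x j then (1:ℝ) else 0) ≤ 1/2)
    (h : Fin n → Bool) (hh : (n : ℝ) ^ (-(a : ℝ)) ≤ P h) :
    (∑ j, (if h j then (1:ℝ) else 0)) ≤ (25/3 : ℝ) * a * (K + 1) * Real.log n := by
  obtain ⟨I, hIS, hI, hcard⟩ := exists_isIndepSet_subset_card_le G hdeg
    (univ.filter fun j => h j = true)
  have hPh : P h ≤ (1 / 2 : ℝ) ^ #I := by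
    refine le_trans ?_ (sum_filter_true_on_isIndepSet_le P hP0 hP1 G
      (fun A B hAB hadj f g => by convert hdep A B hAB hadj f g) (by norm_num) hmean I hI)
    refine single_le_sum (f := P) (fun x _ => hP0 x) ?_
    simpa using fun j hj => (mem_filter.1 (hIS hj)).2
  have hn0 : (0 : ℝ) < n := by positivity
  have hlog := Real.log_le_log (Real.rpow_pos_of_pos hn0 _) (hh.trans hPh)
  rw [Real.log_rpow hn0, Real.log_pow, one_div, Real.log_inv] at hlog
  have hlogn : 0 ≤ Real.log n := Real.log_natCast_nonneg n
  have hIcard : (#I : ℝ) ≤ 25 / 3 * a * Real.log n := by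
    have hlog2 : (#I : ℝ) * (1 / 2) ≤ #I * Real.log 2 := by
      have := Real.log_two_gt_d9
      gcongr
      linarith
    have : 0 ≤ (a : ℝ) * Real.log n := by positivity
    linarith
  have hweight : (∑ j, if h j then (1 : ℝ) else 0) ≤ #I * (K + 1) := by
    rw [sum_boole]
    exact_mod_cast hcard
  calc (∑ j, if h j then (1 : ℝ) else 0) ≤ #I * (K + 1) := hweight
    _ ≤ 25 / 3 * a * Real.log n * (K + 1) := by gcongr
    _ = 25 / 3 * a * (K + 1) * Real.log n := by ring
end

section
/- Let S and R be nonempty finite index sets with a distinguished element 0 ∈ S, and let ρ be a positive semidefinite complex matrix indexed by S × R with Tr(ρ) = 1. Define the pinched matrix M(ρ) by M(ρ)_{(z,r),(z',r')} = δ_{z,z'}·ρ_{(z,r),(z,r')} and the replaced matrix E(ρ) by E(ρ)_{(z,r),(z',r')} = δ_{z,0}·δ_{z',0}·∑_{w∈S} ρ_{(w,r),(w,r')}. If ∑_{r∈R} ρ_{(0,r),(0,r)} ≥ 0.99, then the trace norm satisfies ‖M(ρ) − E(ρ)‖₁ ≤ 0.02. -/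
open Matrix Finset
open scoped ComplexOrder

/-- The pinching `M(ρ)` of a bipartite density matrix: measure the `S`-subsystem in
the standard basis, i.e. `M(ρ)_{(z,r),(z',r')} = δ_{z,z'} ρ_{(z,r),(z,r')}`. -/
noncomputable def measureFirst {S R : Type*} [Fintype S] [Fintype R] [DecidableEq S]
    (ρ : Matrix (S × R) (S × R) ℂ) : Matrix (S × R) (S × R) ℂ :=
  fun p q => if p.1 = q.1 then ρ p q else 0

/-- The map `E(ρ)`: trace out the `S`-subsystem and replace it by `|z0⟩⟨z0|`, i.e.
`E(ρ)_{(z,r),(z',r')} = δ_{z,z0} δ_{z',z0} ∑_w ρ_{(w,r),(w,r')}`. -/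
noncomputable def replaceFirst {S R : Type*} [Fintype S] [Fintype R] [DecidableEq S]
    (z0 : S) (ρ : Matrix (S × R) (S × R) ℂ) : Matrix (S × R) (S × R) ℂ :=
  fun p q => if p.1 = z0 ∧ q.1 = z0 then ∑ w : S, ρ (w, p.2) (w, q.2) else 0

open scoped Kronecker

/-- The eigenvalues of a Hermitian difference of positive semidefinite matrices have absolute
values summing to at most the sum of the two traces. -/
theorem Matrix.IsHermitian.sum_abs_eigenvalues_sub_le {n : Type*} [Fintype n] [DecidableEq n]
    {P Q : Matrix n n ℂ} (hP : P.PosSemidef) (hQ : Q.PosSemidef) (h : (P - Q).IsHermitian) :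
    ∑ i, |h.eigenvalues i| ≤ P.trace.re + Q.trace.re := by
  set U : Matrix n n ℂ := (h.eigenvectorUnitary : Matrix n n ℂ)
  have hUU : U * Uᴴ = 1 := Unitary.coe_mul_star_self h.eigenvectorUnitary
  have trace_conj (X : Matrix n n ℂ) : (Uᴴ * X * U).trace = X.trace := by
    rw [Matrix.trace_mul_comm, ← Matrix.mul_assoc, hUU, Matrix.one_mul]
  have diag_eq (i : n) :
      h.eigenvalues i = ((Uᴴ * P * U) i i).re - ((Uᴴ * Q * U) i i).re := by
    have key : Uᴴ * (P - Q) * U = diagonal (fun i => (h.eigenvalues i : ℂ)) := by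
      have hdiag := h.conjStarAlgAut_star_eigenvectorUnitary
      rwa [Unitary.conjStarAlgAut_star_apply] at hdiag
    rw [Matrix.mul_sub, Matrix.sub_mul] at key
    have := congrArg Complex.re (congrFun (congrFun key i) i)
    simpa using this.symm
  have diag_nonneg {X : Matrix n n ℂ} (hX : X.PosSemidef) (i : n) :
      0 ≤ ((Uᴴ * X * U) i i).re :=
    (Complex.le_def.1 ((hX.conjTranspose_mul_mul_same U).diag_nonneg (i := i))).1
  calc ∑ i, |h.eigenvalues i|
      ≤ ∑ i, (((Uᴴ * P * U) i i).re + ((Uᴴ * Q * U) i i).re) := by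
        refine Finset.sum_le_sum fun i _ => ?_
        rw [diag_eq, abs_le]
        constructor <;> linarith [diag_nonneg hP i, diag_nonneg hQ i]
    _ = P.trace.re + Q.trace.re := by
        rw [Finset.sum_add_distrib, ← trace_conj P, ← trace_conj Q]
        simp [Matrix.trace]

/-- Measuring minus replacing moves every diagonal block off `z0` to the `z0` position. -/
theorem measureFirst_sub_replaceFirst {S R : Type*} [Fintype S] [Fintype R] [DecidableEq S]
    (z0 : S) (ρ : Matrix (S × R) (S × R) ℂ) :
    measureFirst ρ - replaceFirst z0 ρ =
      ∑ w ∈ univ.erase z0, single w w (1 : ℂ) ⊗ₖ ρ.submatrix (Prod.mk w) (Prod.mk w) -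
        ∑ w ∈ univ.erase z0, single z0 z0 (1 : ℂ) ⊗ₖ ρ.submatrix (Prod.mk w) (Prod.mk w) := by
  have hM : measureFirst ρ =
      ∑ w, single w w (1 : ℂ) ⊗ₖ ρ.submatrix (Prod.mk w) (Prod.mk w) := by
    ext ⟨a, r⟩ ⟨b, s⟩
    simp only [measureFirst, Matrix.sum_apply, kroneckerMap_apply, single_apply, submatrix_apply]
    by_cases hab : a = b
    · subst hab
      simp
    · rw [if_neg hab, Finset.sum_eq_zero]
      intro w _
      rw [if_neg (fun h => hab (h.1.symm.trans h.2)), zero_mul]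
  have hE : replaceFirst z0 ρ =
      ∑ w, single z0 z0 (1 : ℂ) ⊗ₖ ρ.submatrix (Prod.mk w) (Prod.mk w) := by
    ext ⟨a, r⟩ ⟨b, s⟩
    simp [replaceFirst, Matrix.sum_apply, single_apply, eq_comm]
  rw [hM, hE, ← Finset.add_sum_erase _ _ (mem_univ z0), ← Finset.add_sum_erase _ _ (mem_univ z0),
    add_sub_add_left_eq_sub]

/-- if a density matrix `ρ` on `S × R` satisfies
`Tr(ρ (|z0⟩⟨z0| ⊗ I)) ≥ 0.99`, then `‖M(ρ) − E(ρ)‖₁ ≤ 0.02`, where the trace norm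
of a Hermitian matrix is the sum of the absolute values of its eigenvalues. -/
theorem stmt_15 {S R : Type*} [Fintype S] [Fintype R] [Nonempty S] [Nonempty R]
    [DecidableEq S] [DecidableEq R]
    (z0 : S)
    (ρ : Matrix (S × R) (S × R) ℂ)
    (hρ : ρ.PosSemidef) (hρ1 : ρ.trace = 1)
    (hheavy : (0.99 : ℝ) ≤ ∑ r : R, (ρ (z0, r) (z0, r)).re)
    (hHerm : (measureFirst ρ - replaceFirst z0 ρ).IsHermitian) :
    ∑ i, |hHerm.eigenvalues i| ≤ (0.02 : ℝ) := by
  have posSemidef_single (z : S) : (single z z (1 : ℂ)).PosSemidef := by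
    rw [← diagonal_single]
    exact PosSemidef.diagonal (Pi.single_nonneg.2 zero_le_one)
  have posSemidef_blocks (f : S → S) : (∑ w ∈ univ.erase z0,
      single (f w) (f w) (1 : ℂ) ⊗ₖ ρ.submatrix (Prod.mk w) (Prod.mk w)).PosSemidef :=
    posSemidef_sum _ fun w _ => (posSemidef_single (f w)).kronecker (hρ.submatrix _)
  have trace_blocks_le (f : S → S) : (∑ w ∈ univ.erase z0,
      single (f w) (f w) (1 : ℂ) ⊗ₖ ρ.submatrix (Prod.mk w) (Prod.mk w)).trace.re ≤ 0.01 := by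
    have htotal : ∑ w, ∑ r, (ρ (w, r) (w, r)).re = 1 := by
      have := congrArg Complex.re hρ1
      simpa [Matrix.trace, Fintype.sum_prod_type] using this
    rw [← Finset.add_sum_erase _ _ (mem_univ z0)] at htotal
    simp only [trace_sum, trace_kronecker, trace_single_eq_same, one_mul]
    simp only [Matrix.trace, diag_apply, submatrix_apply, Complex.re_sum]
    linarith
  have hdecomp := measureFirst_sub_replaceFirst z0 ρ
  generalize measureFirst ρ - replaceFirst z0 ρ = A at hdecomp hHerm
  subst hdecomp
  have hle := Matrix.IsHermitian.sum_abs_eigenvalues_sub_le (posSemidef_blocks id)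
    (posSemidef_blocks fun _ => z0) hHerm
  have hP := trace_blocks_le id
  have hQ := trace_blocks_le fun _ => z0
  simp only [id] at hle hP
  linarith
end
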